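/- For all 0 < r ≤ R, the inverse function Φ⁻¹ satisfies (R/r)^{1/2} ≤ Φ⁻¹(R)/Φ⁻¹(r) ≤ a₁^{−1/α₁} (R/r)^{1/α₁}, where a₁ > 0 and α₁ ∈ (0,2] are the constants in the lower weak scaling condition for φ. -/

import Mathlib

open MeasureTheory Filter Set

attribute [local instance] Classical.propDecidable

noncomputable def Phi (φ : ℝ → ℝ) (r : ℝ) : ℝ :=
  if r ≤ 1 then r ^ 2 / (2 * ∫ s in Set.Ioo (0:ℝ) r, s / φ s)
  else (1 / (2 * ∫ s in Set.Ioo (0:ℝ) 1, s / φ s)) * r ^ 2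

structure PhiInvSpec (φ Φinv : ℝ → ℝ) : Prop where
  pos : ∀ t : ℝ, 0 < t → 0 < Φinv t
  right_inv : ∀ t : ℝ, 0 < t → Phi φ (Φinv t) = t
  left_inv : ∀ r : ℝ, 0 < r → Φinv (Phi φ r) = r

/-- On the positive half-line `Phi` is `r ^ 2 / (2 * J (min r 1))` for `J x = ∫ s in 0..x, s / φ s`. -/
theorem Phi_eq_div_intervalIntegral (φ : ℝ → ℝ) {r : ℝ} (hr : 0 < r) :
    Phi φ r = r ^ 2 / (2 * ∫ s in (0:ℝ)..min r 1, s / φ s) := by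
  rw [intervalIntegral.integral_of_le (le_min hr.le zero_le_one), integral_Ioc_eq_integral_Ioo]
  unfold Phi
  split_ifs with h
  · rw [min_eq_left h]
  · rw [min_eq_right (not_le.mp h).le]
    ring

/-- A lower bound `c * φ s ≤ φ (s * (v / u))` transfers to the integrals of `s / φ s`. -/
theorem mul_integral_div_le_of_mul_le {φ : ℝ → ℝ} {u v c : ℝ} (hu : 0 < u) (hv : 0 < v)
    (hc : 0 < c) (hpos : ∀ s ∈ Ioo 0 u, 0 < φ s)
    (hle : ∀ s ∈ Ioo 0 u, c * φ s ≤ φ (s * (v / u)))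
    (hiu : IntervalIntegrable (fun s => s / φ s) volume 0 u)
    (hiv : IntervalIntegrable (fun s => s / φ s) volume 0 v) :
    c * ∫ s in (0:ℝ)..v, s / φ s ≤ (v / u) ^ 2 * ∫ s in (0:ℝ)..u, s / φ s := by
  have hk : 0 < v / u := div_pos hv hu
  have huv : u * (v / u) = v := by field_simp
  have hsub : ∫ s in (0:ℝ)..v, s / φ s
      = (v / u) * ∫ s in (0:ℝ)..u, (s * (v / u)) / φ (s * (v / u)) := by
    rw [intervalIntegral.integral_comp_mul_right (fun s => s / φ s) hk.ne', zero_mul, huv,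
      smul_eq_mul, mul_inv_cancel_left₀ hk.ne']
  have hint : IntervalIntegrable (fun s => (s * (v / u)) / φ (s * (v / u))) volume 0 u := by
    have h := hiv.comp_mul_right (c := v / u)
    rwa [zero_div, div_div_cancel₀ hv.ne'] at h
  have hmono : ∫ s in (0:ℝ)..u, c * ((s * (v / u)) / φ (s * (v / u)))
      ≤ ∫ s in (0:ℝ)..u, (v / u) * (s / φ s) := by
    refine intervalIntegral.integral_mono_on_of_le_Ioo hu.le (hint.const_mul c)
      (hiu.const_mul (v / u)) fun s hs => ?_
    have hφ := hpos s hs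
    have hφ' : 0 < φ (s * (v / u)) := (mul_pos hc hφ).trans_le (hle s hs)
    rw [← mul_div_assoc c, ← mul_div_assoc (v / u), div_le_div_iff₀ hφ' hφ]
    have := mul_le_mul_of_nonneg_left (hle s hs) (mul_pos hs.1 hk).le
    linarith
  rw [intervalIntegral.integral_const_mul, intervalIntegral.integral_const_mul] at hmono
  rw [hsub]
  nlinarith [mul_le_mul_of_nonneg_left hmono hk.le]

/-- Weak scaling of `Phi`, with the lower bound split into monotonicity and the `α₁` bound. -/
theorem Phi_scaling {φ : ℝ → ℝ} {a₁ α₁ : ℝ}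
    (hφmono : StrictMonoOn φ (Icc 0 1)) (hφzero : φ 0 = 0) (ha₁ : 0 < a₁) (hα₁' : α₁ ≤ 2)
    (hLS : ∀ r R : ℝ, 0 < r → r ≤ R → R ≤ 1 → a₁ * (R / r) ^ α₁ ≤ φ R / φ r)
    (hI : IntegrableOn (fun s => s / φ s) (Ioo (0:ℝ) 1)) {u v : ℝ} (hu : 0 < u) (huv : u ≤ v) :
    Phi φ u ≤ Phi φ v ∧ Phi φ v ≤ (v / u) ^ 2 * Phi φ u ∧
      a₁ * (v / u) ^ α₁ * Phi φ u ≤ Phi φ v := by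
  have hpos : ∀ s, 0 < s → s ≤ 1 → 0 < φ s := fun s h0 h1 =>
    hφzero ▸ hφmono ⟨le_rfl, zero_le_one⟩ ⟨h0.le, h1⟩ h0
  have hv : 0 < v := hu.trans_le huv
  have hii : ∀ x, 0 < x → x ≤ 1 → IntervalIntegrable (fun s => s / φ s) volume 0 x := by
    intro x h0 h1
    rw [intervalIntegrable_iff_integrableOn_Ioo_of_le h0.le]
    exact hI.mono_set (Ioo_subset_Ioo_right h1)
  have hJpos : ∀ x, 0 < x → x ≤ 1 → 0 < ∫ s in (0:ℝ)..x, s / φ s := fun x h0 h1 =>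
    intervalIntegral.intervalIntegral_pos_of_pos_on (hii x h0 h1)
      (fun s hs => div_pos hs.1 (hpos s hs.1 (hs.2.le.trans h1))) h0
  have hU : 0 < min u 1 := lt_min hu one_pos
  have hV : 0 < min v 1 := lt_min hv one_pos
  have hU1 : min u 1 ≤ 1 := min_le_right _ _
  have hV1 : min v 1 ≤ 1 := min_le_right _ _
  have hUV : min u 1 ≤ min v 1 := min_le_min_right _ huv
  have hk0 : 0 < min v 1 / min u 1 := div_pos hV hU
  have hk1 : 1 ≤ min v 1 / min u 1 := (one_le_div hU).mpr hUV
  have hq0 : 0 < v / u := div_pos hv hu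
  have hkq : min v 1 / min u 1 ≤ v / u := by
    rw [div_le_div_iff₀ hU hu]
    rcases le_total v 1 with h | h
    · rw [min_eq_left h, min_eq_left (huv.trans h)]
    · rw [min_eq_right h, one_mul, mul_min_of_nonneg _ _ hv.le]
      exact le_min (le_mul_of_one_le_left hu.le h) (by linarith)
  have hscale : ∀ s ∈ Ioo 0 (min u 1),
      s ≤ s * (min v 1 / min u 1) ∧ s * (min v 1 / min u 1) ≤ 1 := by
    refine fun s hs => ⟨le_mul_of_one_le_right hs.1.le hk1, ?_⟩
    rw [← mul_div_assoc, div_le_one hU]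
    exact (mul_le_of_le_one_right hs.1.le hV1).trans hs.2.le
  have hposU : ∀ s ∈ Ioo 0 (min u 1), 0 < φ s := fun s hs => hpos s hs.1 (hs.2.le.trans hU1)
  have hmon := mul_integral_div_le_of_mul_le hU hV one_pos hposU
    (fun s hs => by
      rw [one_mul]
      exact hφmono.monotoneOn ⟨hs.1.le, hs.2.le.trans hU1⟩
        ⟨hs.1.le.trans (hscale s hs).1, (hscale s hs).2⟩ (hscale s hs).1)
    (hii _ hU hU1) (hii _ hV hV1)
  have hlow := mul_integral_div_le_of_mul_le hU hV
    (mul_pos ha₁ (Real.rpow_pos_of_pos hk0 α₁)) hposU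
    (fun s hs => by
      have h := hLS s _ hs.1 (hscale s hs).1 (hscale s hs).2
      rwa [mul_div_cancel_left₀ _ hs.1.ne', le_div_iff₀ (hposU s hs)] at h)
    (hii _ hU hU1) (hii _ hV hV1)
  have hJmono : ∫ s in (0:ℝ)..min u 1, s / φ s ≤ ∫ s in (0:ℝ)..min v 1, s / φ s :=
    intervalIntegral.integral_mono_interval le_rfl hU.le hUV
      ((ae_restrict_iff' measurableSet_Ioc).mpr <| .of_forall fun s hs =>
        (div_pos hs.1 (hpos s hs.1 (hs.2.trans hV1))).le) (hii _ hV hV1)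
  rw [Phi_eq_div_intervalIntegral φ hu, Phi_eq_div_intervalIntegral φ hv]
  have hA := hJpos _ hU hU1
  have hB := hJpos _ hV hV1
  set A := ∫ s in (0:ℝ)..min u 1, s / φ s
  set B := ∫ s in (0:ℝ)..min v 1, s / φ s
  set k := min v 1 / min u 1
  have hvq : v = v / u * u := by field_simp
  set q := v / u
  have hmon' : B ≤ q ^ 2 * A := by
    rw [one_mul] at hmon
    exact hmon.trans (by gcongr)
  have hlow' : a₁ * q ^ α₁ * B ≤ q ^ 2 * A := by
    have hsplit : ∀ x : ℝ, 0 < x → x ^ 2 = x ^ α₁ * x ^ (2 - α₁) := fun x hx => by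
      rw [← Real.rpow_add hx, add_sub_cancel, Real.rpow_two]
    have hkα := Real.rpow_pos_of_pos hk0 α₁
    have hqα := Real.rpow_pos_of_pos hq0 α₁
    have hexp : k ^ (2 - α₁) ≤ q ^ (2 - α₁) :=
      Real.rpow_le_rpow hk0.le hkq (sub_nonneg.mpr hα₁')
    have h : a₁ * B ≤ k ^ (2 - α₁) * A := by
      rw [hsplit k hk0] at hlow
      exact le_of_mul_le_mul_left (by linarith) hkα
    calc a₁ * q ^ α₁ * B = q ^ α₁ * (a₁ * B) := by ring
      _ ≤ q ^ α₁ * (q ^ (2 - α₁) * A) :=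
        mul_le_mul_of_nonneg_left (h.trans (mul_le_mul_of_nonneg_right hexp hA.le)) hqα.le
      _ = q ^ 2 * A := by rw [hsplit q hq0]; ring
  have hu2 : 0 < u ^ 2 := by positivity
  rw [hvq]
  refine ⟨?_, ?_, ?_⟩
  · rw [div_le_div_iff₀ (by positivity) (by positivity)]
    nlinarith [mul_le_mul_of_nonneg_left hmon' hu2.le]
  · rw [← mul_div_assoc, mul_pow]
    gcongr
  · rw [← mul_div_assoc, div_le_div_iff₀ (by positivity) (by positivity)]
    nlinarith [mul_le_mul_of_nonneg_left hlow' hu2.le]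

/-- weak scaling of the inverse function Φ⁻¹. -/
theorem PhiInv_scaling (φ : ℝ → ℝ) (a₁ α₁ : ℝ)
    (hφcont : ContinuousOn φ (Set.Icc 0 1))
    (hφmono : StrictMonoOn φ (Set.Icc 0 1))
    (hφzero : φ 0 = 0)
    (ha₁ : 0 < a₁) (hα₁ : 0 < α₁) (hα₁' : α₁ ≤ 2)
    (hLS : ∀ r R : ℝ, 0 < r → r ≤ R → R ≤ 1 → a₁ * (R / r) ^ α₁ ≤ φ R / φ r)
    (hI : MeasureTheory.IntegrableOn (fun s => s / φ s) (Set.Ioo (0:ℝ) 1))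
    (Φinv : ℝ → ℝ) (HΦ : PhiInvSpec φ Φinv) :
    ∀ r R : ℝ, 0 < r → r ≤ R →
      (R / r) ^ ((1:ℝ) / 2) ≤ Φinv R / Φinv r
      ∧ Φinv R / Φinv r ≤ a₁ ^ (-(1 / α₁)) * (R / r) ^ (1 / α₁) := by
  intro r R hr hrR
  have hR : 0 < R := hr.trans_le hrR
  have hu := HΦ.pos r hr
  have hv := HΦ.pos R hR
  have hscal := fun {u v : ℝ} (hu : 0 < u) (huv : u ≤ v) =>
    Phi_scaling hφmono hφzero ha₁ hα₁' hLS hI hu huv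
  have huv : Φinv r ≤ Φinv R := by
    by_contra! hlt
    have h := (hscal hv hlt.le).1
    rw [HΦ.right_inv r hr, HΦ.right_inv R hR] at h
    rw [le_antisymm hrR h] at hlt
    exact lt_irrefl _ hlt
  obtain ⟨-, hup, hlow⟩ := hscal hu huv
  rw [HΦ.right_inv r hr, HΦ.right_inv R hR, ← div_le_iff₀ hr] at hup
  rw [HΦ.right_inv r hr, HΦ.right_inv R hR, ← le_div_iff₀ hr] at hlow
  have hq : 0 < Φinv R / Φinv r := div_pos hv hu
  have hRr : 0 < R / r := div_pos hR hr
  constructor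
  · rw [← Real.sqrt_eq_rpow]
    exact Real.sqrt_le_iff.mpr ⟨hq.le, hup⟩
  · have hle : (Φinv R / Φinv r) ^ α₁ ≤ a₁⁻¹ * (R / r) := by
      rwa [← div_eq_inv_mul, le_div_iff₀' ha₁]
    have h := Real.rpow_le_rpow (by positivity) hle (one_div_pos.mpr hα₁).le
    rwa [← Real.rpow_mul hq.le, mul_one_div_cancel hα₁.ne', Real.rpow_one,
      Real.mul_rpow (inv_pos.mpr ha₁).le hRr.le, Real.inv_rpow ha₁.le,
      ← Real.rpow_neg ha₁.le] at h
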